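/- arXiv:1205.2066 — 6 statements merged into one kernel-verified Lean document; each statement's English description precedes it below -/
import Mathlib

section
/- Let η¹, η² : I × ℝ → ℤ be two functions, at least one of which has finite support. Then η² · (C_q η¹)[−1/2] = (C_q η²) · η¹[−1/2]. (Symmetry of the q-Cartan operator, Lemma 2.) -/
namespace GQV

open Matrix

/-- Degree shift `η[d]`, i.e. `η[d]ᵢ(a) = ηᵢ(a + d)`. -/
noncomputable def shift {n : ℕ} (η : Fin n × ℝ → ℤ) (d : ℝ) : Fin n × ℝ → ℤ :=
  fun p => η (p.1, p.2 + d)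

/-- The q-Cartan operator `C_q`. -/
noncomputable def Cq {n : ℕ} (b : Matrix (Fin n) (Fin n) ℤ) (η : Fin n × ℝ → ℤ) : Fin n × ℝ → ℤ :=
  fun p =>
    η (p.1, p.2 + 1 / 2) + η (p.1, p.2 - 1 / 2)
      - ∑ i : Fin n, (if i < p.1 then b i p.1 * η (i, p.2 + 1 / 2) else 0)
      - ∑ j : Fin n, (if p.1 < j then b p.1 j * η (j, p.2 - 1 / 2) else 0)

/-- The pairing `η¹ · η² = Σ_{(i,a)} η¹ᵢ(a) η²ᵢ(a)`. -/
noncomputable def dotP {n : ℕ} (η₁ η₂ : Fin n × ℝ → ℤ) : ℤ := ∑ᶠ p, η₁ p * η₂ p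

/-- The indicator function `e_{k,a}` of `(k,a)`. -/
noncomputable def eind {n : ℕ} (k : Fin n) (a : ℝ) : Fin n × ℝ → ℤ := fun p => if p = (k, a) then 1 else 0

/-- Support contained in `I × ℤ`. -/
def SuppInt {n : ℕ} (η : Fin n × ℝ → ℤ) : Prop := ∀ p, η p ≠ 0 → ∃ m : ℤ, p.2 = (m : ℝ)

/-- Support contained in `I × (ℤ + 1/2)`. -/
def SuppHalfInt {n : ℕ} (η : Fin n × ℝ → ℤ) : Prop :=
  ∀ p, η p ≠ 0 → ∃ m : ℤ, p.2 = (m : ℝ) + 1 / 2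

/-- The set `E`: functions supported on integer arguments, vanishing for all
sufficiently small arguments. -/
def memE {n : ℕ} (η : Fin n × ℝ → ℤ) : Prop :=
  SuppInt η ∧ ∃ N : ℤ, ∀ (k : Fin n) (a : ℝ), a < (N : ℝ) → η (k, a) = 0

/-- The set `E[d] = {η[d] : η ∈ E}`. -/
def memEshift {n : ℕ} (d : ℝ) (η : Fin n × ℝ → ℤ) : Prop :=
  ∃ θ, memE θ ∧ η = shift θ d

/-- Functions on `I × (ℤ + 1/2)` vanishing for all sufficiently small arguments;
this is the set `E[1/2] = E[-1/2]`. -/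
def memEhalf {n : ℕ} (η : Fin n × ℝ → ℤ) : Prop :=
  SuppHalfInt η ∧ ∃ N : ℤ, ∀ (k : Fin n) (a : ℝ), a < (N : ℝ) → η (k, a) = 0

/-- The strictly upper triangular part `b^>`. -/
def bUpper {n : ℕ} (b : Matrix (Fin n) (Fin n) ℤ) : Matrix (Fin n) (Fin n) ℤ :=
  Matrix.of fun i j => if i < j then b i j else 0

/-- `E_Q = 1 - b^>`, the matrix of the Euler form. -/
def EQmat {n : ℕ} (b : Matrix (Fin n) (Fin n) ℤ) : Matrix (Fin n) (Fin n) ℤ := 1 - bUpper b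

/-- The Euler form `⟨x, y⟩ = xᵀ E_Q y`. -/
def euler {n : ℕ} (b : Matrix (Fin n) (Fin n) ℤ) (x y : Fin n → ℤ) : ℤ :=
  x ⬝ᵥ (EQmat b *ᵥ y)

/-- The class `[Ī_i] = E_Q⁻¹ e_i` of the indecomposable injective with socle `S_i`. -/
noncomputable def Iinj {n : ℕ} (b : Matrix (Fin n) (Fin n) ℤ) (i : Fin n) : Fin n → ℤ :=
  (EQmat b)⁻¹ *ᵥ Pi.single i 1

/-- The class `[P̄_i] = E_Q⁻ᵀ e_i` of the indecomposable projective with top `S_i`. -/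
noncomputable def Pproj {n : ℕ} (b : Matrix (Fin n) (Fin n) ℤ) (i : Fin n) : Fin n → ℤ :=
  ((EQmat b)ᵀ)⁻¹ *ᵥ Pi.single i 1

/-- The Coxeter matrix `Φ = -E_Q⁻¹ E_Qᵀ`. -/
noncomputable def Cox {n : ℕ} (b : Matrix (Fin n) (Fin n) ℤ) : Matrix (Fin n) (Fin n) ℤ :=
  -((EQmat b)⁻¹ * (EQmat b)ᵀ)

/-- The map `β`, defined `ℤ`-linearly by `β(e_{i,a}) = -Φ^a [Ī_i]` for `a ∈ ℤ`. -/
noncomputable def betaMap {n : ℕ} (b : Matrix (Fin n) (Fin n) ℤ) (η : Fin n × ℝ → ℤ) :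
    Fin n → ℤ :=
  ∑ᶠ p : Fin n × ℤ, η (p.1, (p.2 : ℝ)) • ((-(Cox b ^ p.2)) *ᵥ Iinj b p.1)

/-- `𝒩(w¹,w²) = w¹[1/2]·C_q⁻¹w² − w¹[−1/2]·C_q⁻¹w² − w²[1/2]·C_q⁻¹w¹ + w²[−1/2]·C_q⁻¹w¹`,
where `u₁ = C_q⁻¹ w¹`, `u₂ = C_q⁻¹ w²` are given as arguments. -/
noncomputable def Ncal {n : ℕ} (w₁ w₂ u₁ u₂ : Fin n × ℝ → ℤ) : ℤ :=
  dotP (shift w₁ (1 / 2)) u₂ - dotP (shift w₁ (-(1 / 2))) u₂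
    - dotP (shift w₂ (1 / 2)) u₁ + dotP (shift w₂ (-(1 / 2))) u₁

/-- `ℰ'(w¹,w²) = −w¹[1/2]·C_q⁻¹w² + w²[1/2]·C_q⁻¹w¹`, where `u₁ = C_q⁻¹ w¹`,
`u₂ = C_q⁻¹ w²` are given as arguments. -/
noncomputable def Ecal {n : ℕ} (w₁ w₂ u₁ u₂ : Fin n × ℝ → ℤ) : ℤ :=
  -dotP (shift w₁ (1 / 2)) u₂ + dotP (shift w₂ (1 / 2)) u₁

/-- The B-matrix of the level-1 ice quiver with z-pattern attached to `Q`. -/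
def Btilde {n : ℕ} (b : Matrix (Fin n) (Fin n) ℤ) : Matrix (Fin n ⊕ Fin n) (Fin n) ℤ :=
  Matrix.of (Sum.elim (fun i k => b i k)
    (fun j k => -(if j = k then 1 else 0) + (if k < j then b k j else 0)))

/-- The index map: the `ℤ`-linear map on functions supported on `I × {-1, 0}`
with `ind(e_{k,0}) = e_k` and `ind(e_{k,-1}) = e_{n+k} - e_k`. -/
noncomputable def indMap {n : ℕ} (w : Fin n × ℝ → ℤ) : Fin n ⊕ Fin n → ℤ :=
  Sum.elim (fun k => w (k, 0) - w (k, -1)) (fun k => w (k, -1))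

end GQV


open Matrix GQV

theorem aux_fin {n : ℕ} (η₁ η₂ : Fin n × ℝ → ℤ)
    (hfin : (Function.support η₁).Finite ∨ (Function.support η₂).Finite)
    (i k : Fin n) (c d : ℝ) :
    (Function.support fun a : ℝ => η₂ (i, a + c) * η₁ (k, a + d)).Finite := by
  rcases hfin with h | h
  · have h2 := h.preimage (f := fun a : ℝ => (k, a + d))
      (by intro x _ y _ hxy; simpa using hxy)
    refine h2.subset ?_
    intro a ha
    simp only [Function.mem_support, Set.mem_preimage] at *
    exact right_ne_zero_of_mul ha
  · have h2 := h.preimage (f := fun a : ℝ => (i, a + c))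
      (by intro x _ y _ hxy; simpa using hxy)
    refine h2.subset ?_
    intro a ha
    simp only [Function.mem_support, Set.mem_preimage] at *
    exact left_ne_zero_of_mul ha

theorem aux_curry {n : ℕ} (F : Fin n × ℝ → ℤ)
    (h : ∀ k, (Function.support fun a => F (k, a)).Finite) :
    ∑ᶠ p, F p = ∑ k, ∑ᶠ a, F (k, a) := by
  rw [finsum_curry, finsum_eq_sum_of_fintype]
  refine (Set.finite_iUnion fun k => (h k).image (fun a => (k, a))).subset ?_
  rintro ⟨k, a⟩ hp
  exact Set.mem_iUnion.2 ⟨k, a, hp, rfl⟩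

noncomputable def auxS {n : ℕ} (η₁ η₂ : Fin n × ℝ → ℤ) (i k : Fin n) (d : ℝ) : ℤ :=
  ∑ᶠ a : ℝ, η₂ (i, a) * η₁ (k, a + d)

theorem auxS_shift {n : ℕ} (η₁ η₂ : Fin n × ℝ → ℤ) (i k : Fin n) (c d : ℝ) :
    ∑ᶠ a : ℝ, η₂ (i, a + c) * η₁ (k, a + d) = auxS η₁ η₂ i k (d - c) := by
  unfold auxS
  rw [← finsum_comp_equiv (Equiv.addRight c) (f := fun a => η₂ (i, a) * η₁ (k, a + (d - c)))]
  simp only [Equiv.coe_addRight]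
  refine finsum_congr fun a => ?_
  rw [show a + c + (d - c) = a + d by ring]

/-- row-wise evaluation of a finite linear combination -/
theorem aux_row {n : ℕ} (f g : ℝ → ℤ) (u v : Fin n → ℝ → ℤ) (x y : Fin n → ℤ)
    (hf : f.support.Finite) (hg : g.support.Finite)
    (hu : ∀ i, (u i).support.Finite) (hv : ∀ i, (v i).support.Finite) :
    (Function.support fun a => f a + g a - ∑ i, x i * u i a - ∑ i, y i * v i a).Finite ∧
    ∑ᶠ a, (f a + g a - ∑ i, x i * u i a - ∑ i, y i * v i a)
      = ∑ᶠ a, f a + ∑ᶠ a, g a - ∑ i, x i * ∑ᶠ a, u i a - ∑ i, y i * ∑ᶠ a, v i a := by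
  have key : ∀ (u : Fin n → ℝ → ℤ) (x : Fin n → ℤ), (∀ i, (u i).support.Finite) →
      (Function.support fun a => ∑ i, x i * u i a).Finite ∧
      ∑ᶠ a, ∑ i, x i * u i a = ∑ i, x i * ∑ᶠ a, u i a := by
    intro u x hu
    have h1 : ∀ i, (Function.support fun a => x i * u i a).Finite := fun i =>
      (hu i).subset fun a ha => right_ne_zero_of_mul ha
    constructor
    · refine (Set.finite_iUnion h1).subset ?_
      intro a ha
      obtain ⟨i, _, hi⟩ := Finset.exists_ne_zero_of_sum_ne_zero ha
      exact Set.mem_iUnion.2 ⟨i, hi⟩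
    · rw [finsum_sum_comm _ _ fun i _ => h1 i]
      exact Finset.sum_congr rfl fun i _ => (mul_finsum _ _).symm
  obtain ⟨hu1, hu2⟩ := key u x hu
  obtain ⟨hv1, hv2⟩ := key v y hv
  have hfg : (Function.support fun a => f a + g a).Finite :=
    (hf.union hg).subset (Function.support_add f g)
  have h3 : (Function.support fun a => f a + g a - ∑ i, x i * u i a).Finite :=
    (hfg.union hu1).subset (Function.support_sub _ _)
  refine ⟨(h3.union hv1).subset (Function.support_sub _ _), ?_⟩
  rw [finsum_sub_distrib h3 hv1, finsum_sub_distrib hfg hu1, finsum_add_distrib hf hg, hu2, hv2]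

/-- symmetry of the q-Cartan operator:
`η² · (C_q η¹)[−1/2] = (C_q η²) · η¹[−1/2]` whenever at least one of `η¹, η²`
has finite support. -/
theorem cq_symmetric (n : ℕ) (hn : 0 < n) (b : Matrix (Fin n) (Fin n) ℤ)
    (hskew : bᵀ = -b) (hsign : ∀ i j : Fin n, i < j → 0 ≤ b i j)
    (η₁ η₂ : Fin n × ℝ → ℤ)
    (hfin : (Function.support η₁).Finite ∨ (Function.support η₂).Finite) :
    GQV.dotP η₂ (GQV.shift (GQV.Cq b η₁) (-(1 / 2)))
      = GQV.dotP (GQV.Cq b η₂) (GQV.shift η₁ (-(1 / 2))) := by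
  have F := aux_fin η₁ η₂ hfin
  have L := fun k : Fin n => aux_row
    (fun a => η₂ (k, a + 0) * η₁ (k, a + 0)) (fun a => η₂ (k, a + 0) * η₁ (k, a + (-1)))
    (fun i a => η₂ (k, a + 0) * η₁ (i, a + 0)) (fun i a => η₂ (k, a + 0) * η₁ (i, a + (-1)))
    (fun i => if i < k then b i k else 0) (fun i => if k < i then b k i else 0)
    (F _ _ _ _) (F _ _ _ _) (fun i => F _ _ _ _) (fun i => F _ _ _ _)
  have R := fun k : Fin n => aux_row
    (fun a => η₂ (k, a + 1 / 2) * η₁ (k, a + -(1 / 2)))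
    (fun a => η₂ (k, a + -(1 / 2)) * η₁ (k, a + -(1 / 2)))
    (fun i a => η₂ (i, a + 1 / 2) * η₁ (k, a + -(1 / 2)))
    (fun i a => η₂ (i, a + -(1 / 2)) * η₁ (k, a + -(1 / 2)))
    (fun i => if i < k then b i k else 0) (fun i => if k < i then b k i else 0)
    (F _ _ _ _) (F _ _ _ _) (fun i => F _ _ _ _) (fun i => F _ _ _ _)
  have eL : ∀ k a, η₂ (k, a) * GQV.shift (GQV.Cq b η₁) (-(1 / 2)) (k, a) =
      η₂ (k, a + 0) * η₁ (k, a + 0) + η₂ (k, a + 0) * η₁ (k, a + (-1))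
      - ∑ i, (if i < k then b i k else 0) * (η₂ (k, a + 0) * η₁ (i, a + 0))
      - ∑ i, (if k < i then b k i else 0) * (η₂ (k, a + 0) * η₁ (i, a + (-1))) := by
    intro k a
    simp only [GQV.shift, GQV.Cq]
    rw [show a + -(1 / 2) + 1 / 2 = a + 0 by ring, show a + -(1 / 2) - 1 / 2 = a + (-1) by ring,
      mul_sub, mul_sub, mul_add, Finset.mul_sum, Finset.mul_sum, add_zero]
    congr 1
    · congr 1
      refine Finset.sum_congr rfl fun i _ => ?_
      split_ifs <;> ring
    · refine Finset.sum_congr rfl fun i _ => ?_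
      split_ifs <;> ring
  have eR : ∀ k a, GQV.Cq b η₂ (k, a) * GQV.shift η₁ (-(1 / 2)) (k, a) =
      η₂ (k, a + 1 / 2) * η₁ (k, a + -(1 / 2)) + η₂ (k, a + -(1 / 2)) * η₁ (k, a + -(1 / 2))
      - ∑ i, (if i < k then b i k else 0) * (η₂ (i, a + 1 / 2) * η₁ (k, a + -(1 / 2)))
      - ∑ i, (if k < i then b k i else 0) * (η₂ (i, a + -(1 / 2)) * η₁ (k, a + -(1 / 2))) := by
    intro k a
    simp only [GQV.shift, GQV.Cq]
    rw [sub_eq_add_neg a (1 / 2),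
      sub_mul, sub_mul, add_mul, Finset.sum_mul, Finset.sum_mul]
    congr 1
    · congr 1
      refine Finset.sum_congr rfl fun i _ => ?_
      split_ifs <;> ring
    · refine Finset.sum_congr rfl fun i _ => ?_
      split_ifs <;> ring
  unfold GQV.dotP
  rw [aux_curry _ (fun k => by simp only [eL]; exact (L k).1),
    aux_curry _ (fun k => by simp only [eR]; exact (R k).1)]
  simp only [eL, eR]
  rw [Finset.sum_congr rfl fun k _ => (L k).2, Finset.sum_congr rfl fun k _ => (R k).2]
  simp only [auxS_shift]
  rw [show (0 : ℝ) - 0 = 0 by ring, show (-1 : ℝ) - 0 = -1 by ring,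
    show (-(1 / 2) : ℝ) - 1 / 2 = -1 by ring, show (-(1 / 2) : ℝ) - -(1 / 2) = 0 by ring]
  simp only [Finset.sum_sub_distrib, Finset.sum_add_distrib]
  rw [Finset.sum_comm (f := fun k i => (if i < k then b i k else 0) * auxS η₁ η₂ k i 0),
    Finset.sum_comm (f := fun k i => (if k < i then b k i else 0) * auxS η₁ η₂ k i (-1))]
  ring
end

section
/- The q-Cartan operator C_q restricts to a bijection from E[1/2] onto E, and to a bijection from E onto E[−1/2]. That is: for every η ∈ E there is a unique θ ∈ E[1/2] with C_q θ = η, and for every η ∈ E[−1/2] there is a unique θ ∈ E with C_q θ = η. -/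
open Matrix GQV

namespace GQV

theorem aux_det {n : ℕ} (b : Matrix (Fin n) (Fin n) ℤ) : (EQmat b).det = 1 := by
  have h : (EQmat b).BlockTriangular id := by
    intro i j hij
    have hij' : j < i := hij
    simp [EQmat, bUpper, hij'.ne', not_lt.mpr hij'.le]
  rw [Matrix.det_of_upperTriangular h]
  simp [EQmat, bUpper]

theorem aux_mul {n : ℕ} (b : Matrix (Fin n) (Fin n) ℤ) (v : Fin n → ℤ) (k : Fin n) :
    (EQmat b *ᵥ v) k = v k - ∑ j : Fin n, (if k < j then b k j * v j else 0) := by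
  simp [EQmat, Matrix.sub_mulVec, Matrix.mulVec, dotProduct, bUpper, Matrix.one_apply, ite_mul, sub_mul]

theorem aux_mulT {n : ℕ} (b : Matrix (Fin n) (Fin n) ℤ) (v : Fin n → ℤ) (k : Fin n) :
    ((EQmat b)ᵀ *ᵥ v) k = v k - ∑ i : Fin n, (if i < k then b i k * v i else 0) := by
  simp [EQmat, Matrix.sub_mulVec, Matrix.mulVec, dotProduct, bUpper, Matrix.one_apply, ite_mul, sub_mul]

/-- Unshifted operator. -/
def Dop {n : ℕ} (b : Matrix (Fin n) (Fin n) ℤ) (φ : Fin n × ℝ → ℤ) : Fin n × ℝ → ℤ :=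
  fun p => ((EQmat b)ᵀ *ᵥ (fun i => φ (i, p.2 + 1))) p.1 + (EQmat b *ᵥ (fun i => φ (i, p.2))) p.1

theorem Cq_shift {n : ℕ} (b : Matrix (Fin n) (Fin n) ℤ) (φ : Fin n × ℝ → ℤ) :
    Cq b (shift φ (1 / 2)) = Dop b φ := by
  funext ⟨k, a⟩
  simp only [Cq, shift, Dop, aux_mul, aux_mulT]
  rw [show a + 1 / 2 + 1 / 2 = a + 1 by ring, show a - 1 / 2 + 1 / 2 = a by ring]
  ring

theorem shift_shift {n : ℕ} (φ : Fin n × ℝ → ℤ) (c d : ℝ) (h : c + d = 0) :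
    shift (shift φ c) d = φ := by
  funext ⟨k, a⟩
  simp only [shift]
  rw [add_assoc, add_comm d, h, add_zero]

theorem Cq_shift' {n : ℕ} (b : Matrix (Fin n) (Fin n) ℤ) (φ : Fin n × ℝ → ℤ) :
    Cq b φ = shift (Dop b φ) (-(1 / 2)) := by
  funext ⟨k, a⟩
  simp only [Cq, shift, Dop, aux_mul, aux_mulT]
  rw [show a + -(1 / 2) + 1 = a + 1 / 2 by ring, show a + -(1 / 2) = a - 1 / 2 by ring]
  ring

/-- Recursive solution. -/
noncomputable def xs {n : ℕ} (b : Matrix (Fin n) (Fin n) ℤ) (η : Fin n × ℝ → ℤ) (N : ℤ) :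
    ℕ → Fin n → ℤ
  | 0 => 0
  | m + 1 => ((EQmat b)ᵀ)⁻¹ *ᵥ
      ((fun k => η (k, ((N + (m : ℤ) : ℤ) : ℝ))) - EQmat b *ᵥ xs b η N m)

theorem exists_D {n : ℕ} (b : Matrix (Fin n) (Fin n) ℤ) (η : Fin n × ℝ → ℤ) (h : memE η) :
    ∃ φ, memE φ ∧ Dop b φ = η := by
  obtain ⟨hs, N, hN⟩ := h
  have hu : IsUnit ((EQmat b)ᵀ).det := by rw [Matrix.det_transpose, aux_det]; exact isUnit_one
  let φ : Fin n × ℝ → ℤ := fun p =>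
    if p.2 = (⌊p.2⌋ : ℝ) then xs b η N (⌊p.2⌋ - N).toNat p.1 else 0
  have hφ : ∀ m : ℤ, (fun i => φ (i, (m : ℝ))) = xs b η N (m - N).toNat := by
    intro m; funext i; simp [φ]
  have hφ0 : ∀ a : ℝ, (¬ ∃ m : ℤ, a = m) → (fun i => φ (i, a)) = 0 := by
    intro a ha; funext i
    have : a ≠ (⌊a⌋ : ℝ) := fun h => ha ⟨_, h⟩
    simp only [φ, if_neg this, Pi.zero_apply]
  refine ⟨φ, ⟨?_, N, ?_⟩, ?_⟩
  · intro p hp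
    by_contra hc
    exact hp (congrFun (hφ0 p.2 hc) p.1)
  · intro k a ha
    by_cases hc : ∃ m : ℤ, a = m
    · obtain ⟨m, rfl⟩ := hc
      have hm : m < N := by exact_mod_cast ha
      rw [show φ (k, (m : ℝ)) = _ from congrFun (hφ m) k, show (m - N).toNat = 0 by omega]
      rfl
    · exact congrFun (hφ0 a hc) k
  · funext ⟨k, a⟩
    simp only [Dop]
    by_cases hc : ∃ m : ℤ, a = m
    · obtain ⟨m, rfl⟩ := hc
      have e : (m : ℝ) + 1 = ((m + 1 : ℤ) : ℝ) := by push_cast; ring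
      rw [e, hφ, hφ]
      by_cases hm : m < N
      · rw [show (m - N).toNat = 0 by omega, show (m + 1 - N).toNat = 0 by omega,
          hN k m (by exact_mod_cast hm)]
        simp [xs]
      · obtain ⟨t, rfl⟩ : ∃ t : ℕ, m = N + t := ⟨(m - N).toNat, by omega⟩
        rw [show (N + (t : ℤ) - N).toNat = t by omega,
          show (N + (t : ℤ) + 1 - N).toNat = t + 1 by omega, xs, Matrix.mulVec_mulVec,
          Matrix.mul_nonsing_inv _ hu, Matrix.one_mulVec]
        simp
    · have hc' : ¬ ∃ m : ℤ, a + 1 = m := by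
        rintro ⟨m, hm⟩
        exact hc ⟨m - 1, by push_cast; linarith⟩
      rw [hφ0 a hc, hφ0 _ hc']
      have : η (k, a) = 0 := by
        by_contra h0
        exact hc (hs _ h0)
      simp [this]

theorem unique_D {n : ℕ} (b : Matrix (Fin n) (Fin n) ℤ) (φ ψ : Fin n × ℝ → ℤ)
    (h1 : memE φ) (h2 : memE ψ) (h : Dop b φ = Dop b ψ) : φ = ψ := by
  obtain ⟨s1, N1, z1⟩ := h1
  obtain ⟨s2, N2, z2⟩ := h2
  have hu : IsUnit ((EQmat b)ᵀ).det := by rw [Matrix.det_transpose, aux_det]; exact isUnit_one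
  have low : ∀ m : ℤ, m < min N1 N2 → ∀ k, φ (k, (m : ℝ)) = ψ (k, (m : ℝ)) := by
    intro m hm k
    rw [z1 k m (by exact_mod_cast (lt_min_iff.mp hm).1),
      z2 k m (by exact_mod_cast (lt_min_iff.mp hm).2)]
  have key : ∀ t : ℕ, ∀ k, φ (k, ((min N1 N2 - 1 + t : ℤ) : ℝ)) =
      ψ (k, ((min N1 N2 - 1 + t : ℤ) : ℝ)) := by
    intro t
    induction t with
    | zero => exact low _ (by omega)
    | succ t ih =>
      have e : ((min N1 N2 - 1 + ((t + 1 : ℕ) : ℤ) : ℤ) : ℝ) =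
          ((min N1 N2 - 1 + t : ℤ) : ℝ) + 1 := by push_cast; ring
      rw [e]
      generalize ((min N1 N2 - 1 + t : ℤ) : ℝ) = a at ih
      have h3 : (EQmat b)ᵀ *ᵥ (fun i => φ (i, a + 1)) = (EQmat b)ᵀ *ᵥ (fun i => ψ (i, a + 1)) := by
        funext k
        have := congrFun h (k, a)
        simp only [Dop, ih] at this
        linarith
      have h4 := congrArg (fun v => ((EQmat b)ᵀ)⁻¹ *ᵥ v) h3
      simp only [Matrix.mulVec_mulVec, Matrix.nonsing_inv_mul _ hu, Matrix.one_mulVec] at h4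
      exact fun k => congrFun h4 k
  funext ⟨k, a⟩
  by_cases hc : ∃ m : ℤ, a = m
  · obtain ⟨m, rfl⟩ := hc
    by_cases hm : m < min N1 N2
    · exact low m hm k
    · have := key (m - (min N1 N2 - 1)).toNat k
      rwa [show min N1 N2 - 1 + (((m - (min N1 N2 - 1)).toNat : ℕ) : ℤ) = m by omega] at this
  · have a1 : φ (k, a) = 0 := by
      by_contra h0
      exact hc (s1 _ h0)
    have a2 : ψ (k, a) = 0 := by
      by_contra h0
      exact hc (s2 _ h0)
    rw [a1, a2]

end GQV

/-- `C_q` restricts to a bijection from `E[1/2]` onto `E`, and to a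
bijection from `E` onto `E[−1/2]`: for every `η ∈ E` there is a unique `θ ∈ E[1/2]`
with `C_q θ = η`, and for every `η ∈ E[−1/2]` there is a unique `θ ∈ E` with
`C_q θ = η`. -/
theorem cq_restricts_to_bijections (n : ℕ) (hn : 0 < n) (b : Matrix (Fin n) (Fin n) ℤ)
    (hskew : bᵀ = -b) (hsign : ∀ i j : Fin n, i < j → 0 ≤ b i j) :
    (∀ η : Fin n × ℝ → ℤ, GQV.memE η →
        ∃! θ : Fin n × ℝ → ℤ, GQV.memEshift (1 / 2) θ ∧ GQV.Cq b θ = η) ∧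
    (∀ η : Fin n × ℝ → ℤ, GQV.memEshift (-(1 / 2)) η →
        ∃! θ : Fin n × ℝ → ℤ, GQV.memE θ ∧ GQV.Cq b θ = η) := by
  constructor
  · intro η hη
    obtain ⟨φ, hφ, hD⟩ := exists_D b η hη
    refine ⟨shift φ (1 / 2), ⟨⟨φ, hφ, rfl⟩, by rw [Cq_shift, hD]⟩, ?_⟩
    rintro θ ⟨⟨ψ, hψ, rfl⟩, hC⟩
    rw [Cq_shift] at hC
    rw [unique_D b ψ φ hψ hφ (hC.trans hD.symm)]
  · rintro η ⟨η₀, hη, rfl⟩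
    obtain ⟨φ, hφ, hD⟩ := exists_D b η₀ hη
    refine ⟨φ, ⟨hφ, by rw [Cq_shift', hD]⟩, ?_⟩
    rintro ψ ⟨hψ, hC⟩
    rw [Cq_shift'] at hC
    have h2 := congrArg (fun f => shift f (1 / 2)) hC
    simp only [shift_shift _ (-(1 / 2) : ℝ) (1 / 2) (by ring)] at h2
    exact unique_D b ψ φ hψ hφ (h2.trans hD.symm)
end

section
/- Let p = (I_n − b^>)^{-1}, where (b^>)_{ij} = b_{ij} if i < j and 0 otherwise; its entry p_{kk'} is the number of (possibly trivial) paths from k to k' in the acyclic quiver Q. For (k,a) ∈ I × ℤ, let ẽ_{k,a} be the unique element of E[1/2] with C_q ẽ_{k,a} = e_{k,a}. Then for every k' ∈ I and every half-integer c ∈ ℤ + 1/2: ẽ_{k,a}(k', c) = 0 if c < a + 1/2, and ẽ_{k,a}(k', a + 1/2) = p_{kk'}. -/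
open Matrix GQV

theorem EQ_det_unit {n : ℕ} (b : Matrix (Fin n) (Fin n) ℤ) : IsUnit (GQV.EQmat b).det := by
  have h : (GQV.EQmat b).BlockTriangular id := by
    intro i j hij
    have hij' : j < i := hij
    simp [GQV.EQmat, GQV.bUpper, Matrix.one_apply, hij'.ne', hij'.le]
  rw [Matrix.det_of_upperTriangular h]
  simp [GQV.EQmat, GQV.bUpper]

theorem Cq_step {n : ℕ} (b : Matrix (Fin n) (Fin n) ℤ) (θ : Fin n × ℝ → ℤ) (m : ℝ)
    (hz : ∀ j, θ (j, m - 1 / 2) = 0) :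
    (fun j => θ (j, m + 1 / 2)) = (fun j => GQV.Cq b θ (j, m)) ᵥ* (GQV.EQmat b)⁻¹ := by
  have h : (fun j => θ (j, m + 1 / 2)) ᵥ* GQV.EQmat b = (fun j => GQV.Cq b θ (j, m)) := by
    funext j
    simp only [GQV.EQmat, Matrix.vecMul_sub, Matrix.vecMul_one, Pi.sub_apply, GQV.Cq, hz,
      mul_zero, ite_self, Finset.sum_const_zero, sub_zero, add_zero]
    congr 1
    simp only [Matrix.vecMul, dotProduct, GQV.bUpper, Matrix.of_apply]
    refine Finset.sum_congr rfl fun i _ => ?_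
    split_ifs <;> ring
  rw [← h, Matrix.vecMul_vecMul, Matrix.mul_nonsing_inv _ (EQ_det_unit b), Matrix.vecMul_one]

/-- the values of `ẽ_{k,a} = C_q⁻¹ e_{k,a}` (the unique element of
`E[1/2]` mapped by `C_q` to `e_{k,a}`): it vanishes at `(k', c)` for half-integers
`c < a + 1/2`, and its value at `(k', a + 1/2)` is the number of paths
`p_{kk'} = ((1 - b^>)⁻¹)_{kk'}`. -/
theorem cq_inverse_of_unit_vector (n : ℕ) (hn : 0 < n) (b : Matrix (Fin n) (Fin n) ℤ)
    (hskew : bᵀ = -b) (hsign : ∀ i j : Fin n, i < j → 0 ≤ b i j)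
    (k : Fin n) (a : ℤ) (θ : Fin n × ℝ → ℤ)
    (hθ : GQV.memEshift (1 / 2) θ) (hCq : GQV.Cq b θ = GQV.eind k (a : ℝ)) :
    (∀ (k' : Fin n) (c : ℝ), (∃ m : ℤ, c = (m : ℝ) + 1 / 2) →
        c < (a : ℝ) + 1 / 2 → θ (k', c) = 0) ∧
    (∀ k' : Fin n, θ (k', (a : ℝ) + 1 / 2) = (GQV.EQmat b)⁻¹ k k') := by
  obtain ⟨η, ⟨-, N, hN⟩, rfl⟩ := hθ
  generalize hθ : GQV.shift η (1 / 2) = θ at *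
  have h0 : ∀ m : ℤ, m + 1 < N → ∀ j, θ (j, (m : ℝ) + 1 / 2) = 0 := by
    intro m hm j
    rw [← hθ]
    apply hN
    have : ((m + 1 : ℤ) : ℝ) < N := by exact_mod_cast hm
    push_cast at this
    linarith
  have hlow : ∀ t : ℕ, ∀ m : ℤ, m + 1 < N + t → m < a → ∀ j, θ (j, (m : ℝ) + 1 / 2) = 0 := by
    intro t
    induction t with
    | zero => intro m hm _ j; exact h0 m (by simpa using hm) j
    | succ t ih =>
      intro m hm hma j
      have hz : ∀ j, θ (j, (m : ℝ) - 1 / 2) = 0 := by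
        intro j
        have := ih (m - 1) (by push_cast at hm; omega) (by omega) j
        rw [← this]
        congr 2
        push_cast
        ring
      have h := Cq_step b θ m hz
      have hc : (fun j => GQV.Cq b θ (j, (m : ℝ))) = 0 := by
        funext j
        have : (m : ℝ) ≠ a := by exact_mod_cast hma.ne
        simp [hCq, GQV.eind, hma.ne]
      rw [hc, Matrix.zero_vecMul] at h
      exact congrFun h j
  have hlow' : ∀ m : ℤ, m < a → ∀ j, θ (j, (m : ℝ) + 1 / 2) = 0 := fun m hm j =>
    hlow (m + 2 - N).toNat m (by omega) hm j
  refine ⟨?_, ?_⟩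
  · rintro k' c ⟨m, rfl⟩ hc
    have : (m : ℝ) < a := by linarith
    exact hlow' m (by exact_mod_cast this) k'
  · intro k'
    have hz : ∀ j, θ (j, (a : ℝ) - 1 / 2) = 0 := by
      intro j
      rw [← hlow' (a - 1) (by omega) j]
      congr 2
      push_cast
      ring
    have h := Cq_step b θ a hz
    have hc : (fun j => GQV.Cq b θ (j, (a : ℝ))) = Pi.single k 1 := by
      funext j
      simp [hCq, GQV.eind, Pi.single_apply]
    rw [hc, Matrix.single_one_vecMul] at h
    exact congrFun h k'
end

section
/- For all finitely supported v¹, v² : I × (ℤ+1/2) → ℤ and w¹, w² : I × ℤ → ℤ, one has d̃'((v¹,w¹),(v²,w²)) = d̃'((0, w¹ − C_q v¹), (0, w² − C_q v²)); equivalently, d((v¹,w¹),(v²,w²)) + d̃_W(w¹,w²) = d̃_W(w¹ − C_q v¹, w² − C_q v²). -/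
open Matrix GQV


namespace GQV

lemma Cq_sub {n : ℕ} (b : Matrix (Fin n) (Fin n) ℤ) (x y : Fin n × ℝ → ℤ) :
    Cq b (x - y) = Cq b x - Cq b y := by
  funext p
  have h1 : ∀ c : ℝ, ∑ i : Fin n, (if i < p.1 then b i p.1 * (x (i, c) - y (i, c)) else 0)
      = ∑ i : Fin n, (if i < p.1 then b i p.1 * x (i, c) else 0)
        - ∑ i : Fin n, (if i < p.1 then b i p.1 * y (i, c) else 0) := by
    intro c
    rw [← Finset.sum_sub_distrib]
    refine Finset.sum_congr rfl fun i _ => ?_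
    split_ifs <;> ring
  have h2 : ∀ c : ℝ, ∑ i : Fin n, (if p.1 < i then b p.1 i * (x (i, c) - y (i, c)) else 0)
      = ∑ i : Fin n, (if p.1 < i then b p.1 i * x (i, c) else 0)
        - ∑ i : Fin n, (if p.1 < i then b p.1 i * y (i, c) else 0) := by
    intro c
    rw [← Finset.sum_sub_distrib]
    refine Finset.sum_congr rfl fun i _ => ?_
    split_ifs <;> ring
  simp only [Cq, Pi.sub_apply, h1, h2]
  ring

lemma Cq_inj {n : ℕ} (b : Matrix (Fin n) (Fin n) ℤ) (x : Fin n × ℝ → ℤ) (N : ℤ)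
    (hN : ∀ (k : Fin n) (a : ℝ), a < (N : ℝ) → x (k, a) = 0) (hx : Cq b x = 0) : x = 0 := by
  have key : ∀ m : ℕ, ∀ (k : Fin n) (a : ℝ), a < (N : ℝ) + m → x (k, a) = 0 := by
    intro m
    induction m with
    | zero => intro k a h; exact hN k a (by simpa using h)
    | succ m ih =>
      intro k
      induction k using WellFoundedLT.induction with
      | ind k ihk =>
        intro a h
        push_cast at h
        have h0 := congrFun hx (k, a - 1 / 2)
        have e1 : a - 1 / 2 + 1 / 2 = a := by ring
        have e2 : a - 1 / 2 - 1 / 2 = a - 1 := by ring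
        simp only [Cq, Pi.zero_apply, e1, e2] at h0
        have hl : a - 1 < (N : ℝ) + m := by linarith
        rw [ih k _ hl, Finset.sum_eq_zero, Finset.sum_eq_zero] at h0
        · simpa using h0
        · intro i _
          rw [ih i _ hl]; simp
        · intro i _
          split_ifs with hi
          · rw [ihk i hi a (by push_cast; linarith)]; simp
          · rfl
  funext ⟨k, a⟩
  obtain ⟨m, hm⟩ := exists_nat_gt (a - N)
  exact key m k a (by linarith)

lemma fin_mul_left {α : Type*} {f : α → ℤ} (g : α → ℤ) (hf : (Function.support f).Finite) :
    (Function.support fun p => f p * g p).Finite :=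
  hf.subset fun p hp => by
    simp only [Function.mem_support] at hp ⊢
    exact left_ne_zero_of_mul hp

lemma fin_shift {n : ℕ} {f : Fin n × ℝ → ℤ} (hf : (Function.support f).Finite) (d : ℝ) :
    (Function.support (shift f d)).Finite := by
  have : Function.support (shift f d) = (fun p : Fin n × ℝ => (p.1, p.2 + d)) ⁻¹'
      Function.support f := rfl
  rw [this]
  refine hf.preimage (Function.Injective.injOn ?_)
  rintro ⟨a, b⟩ ⟨c, e⟩ h
  simpa using h

lemma fin_sec {n : ℕ} {f : Fin n × ℝ → ℤ} (hf : (Function.support f).Finite) (k : Fin n) (d : ℝ) :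
    (Function.support fun a => f (k, a + d)).Finite := by
  have : (Function.support fun a => f (k, a + d)) = (fun a : ℝ => (k, a + d)) ⁻¹'
      Function.support f := rfl
  rw [this]
  refine hf.preimage (Function.Injective.injOn ?_)
  intro a b h
  simpa using h

lemma fin_Cq {n : ℕ} (b : Matrix (Fin n) (Fin n) ℤ) {f : Fin n × ℝ → ℤ}
    (hf : (Function.support f).Finite) : (Function.support (Cq b f)).Finite := by
  have hA : (Prod.snd '' Function.support f).Finite := hf.image _
  refine ((Set.finite_univ (α := Fin n)).prod
    ((hA.image (fun a => a - 1 / 2)).union (hA.image (fun a => a + 1 / 2)))).subset ?_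
  rintro ⟨k, a⟩ h
  by_contra hc
  apply h
  have h1 : ∀ i, f (i, a + 1 / 2) = 0 := by
    intro i
    by_contra h'
    exact hc ⟨trivial, Or.inl ⟨a + 1 / 2, ⟨_, h', rfl⟩, by ring⟩⟩
  have h2 : ∀ i, f (i, a - 1 / 2) = 0 := by
    intro i
    by_contra h'
    exact hc ⟨trivial, Or.inr ⟨a - 1 / 2, ⟨_, h', rfl⟩, by ring⟩⟩
  simp only [Cq, h1, h2]
  simp

lemma dotP_sub_left {n : ℕ} {f g : Fin n × ℝ → ℤ} (h : Fin n × ℝ → ℤ)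
    (hf : (Function.support f).Finite) (hg : (Function.support g).Finite) :
    dotP (f - g) h = dotP f h - dotP g h := by
  unfold dotP
  rw [← finsum_sub_distrib (fin_mul_left h hf) (fin_mul_left h hg)]
  exact finsum_congr fun p => by simp [sub_mul]

lemma dotP_sub_right {n : ℕ} {f : Fin n × ℝ → ℤ} (g h : Fin n × ℝ → ℤ)
    (hf : (Function.support f).Finite) :
    dotP f (g - h) = dotP f g - dotP f h := by
  unfold dotP
  rw [← finsum_sub_distrib (fin_mul_left g hf) (fin_mul_left h hf)]
  exact finsum_congr fun p => by simp [mul_sub]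

lemma dotP_shift {n : ℕ} (f g : Fin n × ℝ → ℤ) (d : ℝ) :
    dotP (shift f d) g = dotP f (shift g (-d)) := by
  unfold dotP
  refine finsum_eq_of_bijective (fun p : Fin n × ℝ => (p.1, p.2 + d))
    ((Equiv.refl (Fin n)).prodCongr (Equiv.addRight d)).bijective ?_
  rintro ⟨k, a⟩
  simp [shift]

lemma dotP_eq {n : ℕ} {f : Fin n × ℝ → ℤ} (g : Fin n × ℝ → ℤ)
    (hf : (Function.support f).Finite) :
    dotP f g = ∑ k, ∑ᶠ a : ℝ, f (k, a) * g (k, a) := by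
  unfold dotP
  rw [finsum_curry _ (fin_mul_left g hf), finsum_eq_sum_of_fintype]

lemma dotP_adj {n : ℕ} (b : Matrix (Fin n) (Fin n) ℤ) (v u : Fin n × ℝ → ℤ)
    (hv : (Function.support v).Finite) :
    dotP (shift (Cq b v) (1 / 2)) u = dotP v (shift (Cq b u) (-(1 / 2))) := by
  rw [dotP_eq _ (fin_shift (fin_Cq b hv) _), dotP_eq _ hv]
  let P : Fin n → Fin n → ℝ → ℤ := fun k l c => ∑ᶠ a : ℝ, v (k, a) * u (l, a - c)
  have hP : ∀ k l c, P k l c = ∑ᶠ a : ℝ, v (k, a + c) * u (l, a) := by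
    intro k l c
    symm
    refine finsum_eq_of_bijective (fun a : ℝ => a + c) (Equiv.addRight c).bijective ?_
    intro a; simp
  have hf0 : ∀ k l c, (Function.support fun a : ℝ => v (k, a) * u (l, a - c)).Finite := by
    intro k l c
    exact fin_mul_left _ (by simpa using fin_sec hv k 0)
  have hf1 : ∀ k l c, (Function.support fun a : ℝ => v (k, a + c) * u (l, a)).Finite := by
    intro k l c
    exact fin_mul_left _ (fin_sec hv k c)
  have sm : ∀ (z : ℤ) {f : ℝ → ℤ}, (Function.support f).Finite →
      (Function.support fun a => z * f a).Finite := by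
    intro z f h
    exact h.subset fun a ha => right_ne_zero_of_mul ha
  have ss : ∀ {f : Fin n → ℝ → ℤ}, (∀ i, (Function.support (f i)).Finite) →
      (Function.support fun a => ∑ i, f i a).Finite := by
    intro f h
    refine (Set.finite_iUnion h).subset fun a ha => ?_
    obtain ⟨i, _, hi⟩ := Finset.exists_ne_zero_of_sum_ne_zero ha
    exact Set.mem_iUnion.2 ⟨i, hi⟩
  have lin : ∀ (A B : ℝ → ℤ) (C D : Fin n → ℝ → ℤ) (x y : Fin n → ℤ),
      (Function.support A).Finite → (Function.support B).Finite →
      (∀ i, (Function.support (C i)).Finite) → (∀ i, (Function.support (D i)).Finite) →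
      ∑ᶠ a, (A a + B a - ∑ i, x i * C i a - ∑ i, y i * D i a) =
      ∑ᶠ a, A a + ∑ᶠ a, B a - ∑ i, x i * ∑ᶠ a, C i a - ∑ i, y i * ∑ᶠ a, D i a := by
    intro A B C D x y hA hB hC hD
    have hAB : (Function.support fun a => A a + B a).Finite :=
      (hA.union hB).subset (Function.support_add A B)
    have hCs := ss fun i => sm (x i) (hC i)
    have hDs := ss fun i => sm (y i) (hD i)
    have hABC : (Function.support fun a => A a + B a - ∑ i, x i * C i a).Finite :=
      (hAB.union hCs).subset (Function.support_sub _ _)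
    rw [finsum_sub_distrib hABC hDs, finsum_sub_distrib hAB hCs, finsum_add_distrib hA hB,
      finsum_sum_comm _ _ fun i _ => sm (x i) (hC i),
      finsum_sum_comm _ _ fun i _ => sm (y i) (hD i)]
    simp only [mul_finsum]
  let M : Fin n → Fin n → ℤ := fun i k => if i < k then b i k else 0
  have hL : ∀ k, ∑ᶠ a : ℝ, shift (Cq b v) (1 / 2) (k, a) * u (k, a) =
      P k k 1 + P k k 0 - ∑ i, M i k * P i k 1 - ∑ j, M k j * P j k 0 := by
    intro k
    simp only [hP]
    rw [← lin _ _ _ _ _ _ (hf1 _ _ _) (hf1 _ _ _) (fun i => hf1 _ _ _) (fun i => hf1 _ _ _)]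
    refine finsum_congr fun a => ?_
    have e1 : a + 1 / 2 + 1 / 2 = a + 1 := by ring
    have e2 : a + 1 / 2 - 1 / 2 = a + 0 := by ring
    simp only [shift, Cq, e1, e2, sub_mul, add_mul, Finset.sum_mul, M, ite_mul, zero_mul, mul_assoc]
  have hR : ∀ k, ∑ᶠ a : ℝ, v (k, a) * shift (Cq b u) (-(1 / 2)) (k, a) =
      P k k 0 + P k k 1 - ∑ i, M i k * P k i 0 - ∑ j, M k j * P k j 1 := by
    intro k
    simp only [P]
    rw [← lin _ _ _ _ _ _ (hf0 _ _ _) (hf0 _ _ _) (fun i => hf0 _ _ _) (fun i => hf0 _ _ _)]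
    refine finsum_congr fun a => ?_
    have e1 : a + -(1 / 2) + 1 / 2 = a - 0 := by ring
    have e2 : a + -(1 / 2) - 1 / 2 = a - 1 := by ring
    simp only [shift, Cq, e1, e2, mul_sub, mul_add, Finset.mul_sum, M, mul_ite, ite_mul, zero_mul,
      mul_zero, mul_left_comm]
  simp only [hL, hR, Finset.sum_sub_distrib, Finset.sum_add_distrib]
  rw [Finset.sum_comm (f := fun k i => M i k * P i k 1),
    Finset.sum_comm (f := fun k i => M k i * P i k 0)]
  ring

end GQV

/-- `d((v¹,w¹),(v²,w²)) + d̃_W(w¹,w²) = d̃_W(w¹ − C_q v¹, w² − C_q v²)`,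
i.e. `d̃'((v¹,w¹),(v²,w²)) = d̃'((0, w¹ − C_q v¹), (0, w² − C_q v²))`. Here
`u₂ = C_q⁻¹ w²` and `u₂' = C_q⁻¹(w² − C_q v²)` are the unique elements of `E[1/2]`
mapped by `C_q` to `w²` resp. `w² − C_q v²`. -/
theorem dtilde_reduction (n : ℕ) (hn : 0 < n) (b : Matrix (Fin n) (Fin n) ℤ)
    (hskew : bᵀ = -b) (hsign : ∀ i j : Fin n, i < j → 0 ≤ b i j)
    (v₁ v₂ w₁ w₂ : Fin n × ℝ → ℤ)
    (hv₁ : (Function.support v₁).Finite) (hv₁s : GQV.SuppHalfInt v₁)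
    (hv₂ : (Function.support v₂).Finite) (hv₂s : GQV.SuppHalfInt v₂)
    (hw₁ : (Function.support w₁).Finite) (hw₁s : GQV.SuppInt w₁)
    (hw₂ : (Function.support w₂).Finite) (hw₂s : GQV.SuppInt w₂)
    (u₂ : Fin n × ℝ → ℤ) (hu₂ : GQV.memEhalf u₂) (hu₂Cq : GQV.Cq b u₂ = w₂)
    (u₂' : Fin n × ℝ → ℤ) (hu₂' : GQV.memEhalf u₂')
    (hu₂'Cq : GQV.Cq b u₂' = w₂ - GQV.Cq b v₂) :
    (GQV.dotP (w₁ - GQV.Cq b v₁) (GQV.shift v₂ (-(1 / 2)))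
        + GQV.dotP v₁ (GQV.shift w₂ (-(1 / 2))))
      + (-GQV.dotP (GQV.shift w₁ (1 / 2)) u₂)
      = -GQV.dotP (GQV.shift (w₁ - GQV.Cq b v₁) (1 / 2)) u₂' := by
  have hsub : u₂' = u₂ - v₂ := by
    obtain ⟨_, N, hN⟩ := hu₂
    obtain ⟨_, N', hN'⟩ := hu₂'
    obtain ⟨L, hL⟩ : ∃ L : ℤ, ∀ (k : Fin n) (a : ℝ), a < (L : ℝ) → v₂ (k, a) = 0 := by
      obtain ⟨c, hc⟩ := (hv₂.image Prod.snd).bddBelow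
      obtain ⟨L, hL⟩ := exists_int_lt c
      refine ⟨L, fun k a ha => ?_⟩
      by_contra h
      have : c ≤ a := hc ⟨(k, a), h, rfl⟩
      linarith
    have h0 := GQV.Cq_inj b (u₂' - (u₂ - v₂)) (min (min N N') L) (by
      intro k a ha
      simp only [Int.cast_min, lt_min_iff] at ha
      simp [hN k a ha.1.1, hN' k a ha.1.2, hL k a ha.2]) (by
      rw [GQV.Cq_sub, GQV.Cq_sub, hu₂'Cq, hu₂Cq, sub_self])
    exact sub_eq_zero.1 h0
  have hC := GQV.fin_Cq b hv₁
  have hd : (Function.support (w₁ - GQV.Cq b v₁)).Finite :=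
    (hw₁.union hC).subset (Function.support_sub _ _)
  have e : GQV.shift (w₁ - GQV.Cq b v₁) (1 / 2)
      = GQV.shift w₁ (1 / 2) - GQV.shift (GQV.Cq b v₁) (1 / 2) := rfl
  rw [hsub, GQV.dotP_sub_right _ _ (GQV.fin_shift hd _), GQV.dotP_shift _ v₂, e,
    GQV.dotP_sub_left u₂ (GQV.fin_shift hw₁ _) (GQV.fin_shift hC _), GQV.dotP_adj b v₁ u₂ hv₁,
    hu₂Cq]
  ring
end

section
/- For every finitely supported v : I × (ℤ+1/2) → ℤ (in particular for every v with values in ℕ), one has β(C_q v) = 0 in ℤ^n. -/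
open Matrix GQV

theorem det_EQ {n : ℕ} (b : Matrix (Fin n) (Fin n) ℤ) : (EQmat b).det = 1 := by
  rw [Matrix.det_of_upperTriangular]
  · apply Finset.prod_eq_one
    intro i _
    simp [EQmat, bUpper]
  · intro i j hij
    simp only [id] at hij
    simp [EQmat, bUpper, Matrix.one_apply, hij.ne', hij.not_gt]

theorem Cq_eq {n : ℕ} (b : Matrix (Fin n) (Fin n) ℤ) (v : Fin n × ℝ → ℤ) (a : ℝ) :
    (fun k => Cq b v (k, a)) = (EQmat b)ᵀ *ᵥ (fun k => v (k, a + 1 / 2))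
      + EQmat b *ᵥ (fun k => v (k, a - 1 / 2)) := by
  ext k
  simp only [EQmat, Matrix.transpose_sub, Matrix.transpose_one, Matrix.sub_mulVec,
    Matrix.one_mulVec, Pi.add_apply, Pi.sub_apply, Cq]
  simp only [Matrix.mulVec, dotProduct, bUpper, Matrix.transpose_apply, Matrix.of_apply, ite_mul,
    zero_mul]
  ring

theorem sum_eq {n : ℕ} (b : Matrix (Fin n) (Fin n) ℤ) (w : Fin n → ℤ) (M : Matrix (Fin n) (Fin n) ℤ) :
    ∑ k, w k • ((-M) *ᵥ Iinj b k) = -(M *ᵥ ((EQmat b)⁻¹ *ᵥ w)) := by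
  have h : w = ∑ k, w k • (Pi.single k 1 : Fin n → ℤ) := by
    ext j
    simp [Finset.sum_apply, Pi.single_apply]
  conv_rhs => rw [h]
  simp only [Matrix.mulVec_sum, Matrix.mulVec_smul, Iinj, Matrix.neg_mulVec, smul_neg,
    Finset.sum_neg_distrib]

/-- for every finitely supported `v : I × (ℤ+1/2) → ℤ`,
`β(C_q v) = 0` in `ℤⁿ`. -/
theorem beta_cq_eq_zero (n : ℕ) (hn : 0 < n) (b : Matrix (Fin n) (Fin n) ℤ)
    (hskew : bᵀ = -b) (hsign : ∀ i j : Fin n, i < j → 0 ≤ b i j)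
    (v : Fin n × ℝ → ℤ) (hvfin : (Function.support v).Finite)
    (hvs : GQV.SuppHalfInt v) :
    GQV.betaMap b (GQV.Cq b v) = 0 := by
  have hdet := det_EQ b
  have hE : IsUnit (EQmat b).det := by rw [hdet]; exact isUnit_one
  have hC : IsUnit (Cox b).det := by
    rw [Cox, Matrix.det_neg, Matrix.det_mul, Matrix.det_transpose, Matrix.det_nonsing_inv, hdet]
    simp only [Ring.inverse_one, mul_one]
    exact isUnit_one.neg.pow _
  let f : ℤ → Fin n → ℤ := fun a => (Cox b ^ a) *ᵥ (fun k => v (k, (a : ℝ) - 1 / 2))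
  have hfinA : {a : ℤ | ∃ k, v (k, (a : ℝ) - 1 / 2) ≠ 0}.Finite := by
    have h1 : ((fun p : Fin n × ℝ => p.2 + 1 / 2) '' Function.support v).Finite := hvfin.image _
    refine (h1.preimage (f := fun a : ℤ => (a : ℝ)) (Int.cast_injective.injOn)).subset ?_
    rintro a ⟨k, hk⟩
    exact ⟨(k, (a : ℝ) - 1 / 2), hk, by simp⟩
  have hfinB : {a : ℤ | ∃ k, v (k, (a : ℝ) + 1 / 2) ≠ 0}.Finite := by
    have h1 : ((fun p : Fin n × ℝ => p.2 - 1 / 2) '' Function.support v).Finite := hvfin.image _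
    refine (h1.preimage (f := fun a : ℤ => (a : ℝ)) (Int.cast_injective.injOn)).subset ?_
    rintro a ⟨k, hk⟩
    exact ⟨(k, (a : ℝ) + 1 / 2), hk, by simp⟩
  have hf : (Function.support f).Finite := by
    refine hfinA.subset fun a ha => ?_
    by_contra hcon
    simp only [Set.mem_setOf_eq, not_exists, not_not] at hcon
    apply ha
    have : (fun k => v (k, (a : ℝ) - 1 / 2)) = 0 := funext hcon
    simp only [f, this, Matrix.mulVec_zero]
  have hf' : (Function.support fun a => f (a + 1)).Finite :=
    hf.preimage (f := fun a : ℤ => a + 1) (add_left_injective 1).injOn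
  have key : ∀ a : ℤ, ∑ k, Cq b v (k, (a : ℝ)) • ((-(Cox b ^ a)) *ᵥ Iinj b k)
      = f (a + 1) - f a := by
    intro a
    rw [sum_eq b (fun k => Cq b v (k, (a : ℝ))), Cq_eq, Matrix.mulVec_add, Matrix.mulVec_mulVec,
      Matrix.mulVec_mulVec, Matrix.nonsing_inv_mul _ hE, Matrix.one_mulVec, Matrix.mulVec_add,
      neg_add, ← sub_eq_add_neg]
    congr 1
    have h2 : ((a + 1 : ℤ) : ℝ) - 1 / 2 = (a : ℝ) + 1 / 2 := by push_cast; ring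
    simp only [f, h2]
    rw [Matrix.zpow_add_one hC]
    simp only [Cox, Matrix.mul_neg, Matrix.neg_mulVec, Matrix.mulVec_mulVec, Matrix.mul_assoc]
  have hsupp : (Function.support fun p : Fin n × ℤ =>
      Cq b v (p.1, (p.2 : ℝ)) • ((-(Cox b ^ p.2)) *ᵥ Iinj b p.1)).Finite := by
    refine ((Set.finite_univ (α := Fin n)).prod (hfinA.union hfinB)).subset ?_
    rintro ⟨k, a⟩ ha
    refine ⟨trivial, ?_⟩
    by_contra hcon
    simp only [Set.mem_union, Set.mem_setOf_eq, not_or, not_exists, not_not] at hcon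
    apply ha
    have h3 : Cq b v (k, (a : ℝ)) = 0 := by
      simp only [Cq, hcon.1, hcon.2]
      simp
    simp only [h3, zero_smul]
  unfold betaMap
  rw [← finsum_comp_equiv (Equiv.prodComm ℤ (Fin n))]
  rw [finsum_curry _ (hsupp.preimage (Equiv.prodComm ℤ (Fin n)).injective.injOn)]
  simp only [Equiv.prodComm_apply, Prod.swap_prod_mk, Prod.fst_swap, Prod.snd_swap,
    finsum_eq_sum_of_fintype, key]
  rw [finsum_sub_distrib hf' hf, sub_eq_zero]
  exact finsum_comp_equiv (Equiv.addRight (1 : ℤ)) (f := f)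
end

section
/- For all i, j ∈ I: ℰ'(e_i(0), e_j(0)) = 0. -/
open Matrix GQV

theorem GQV.vanish_aux {n : ℕ} (b : Matrix (Fin n) (Fin n) ℤ) (j : Fin n) (u : Fin n × ℝ → ℤ)
    (hu : GQV.memEhalf u) (h : GQV.Cq b u = GQV.eind j (0 : ℝ)) (k : Fin n) (a : ℝ)
    (ha : a < 1 / 2) : u (k, a) = 0 := by
  obtain ⟨-, N, hN⟩ := hu
  have key : ∀ t : ℕ, ∀ (a : ℝ), a < 1 / 2 → a < (N : ℝ) + t → ∀ k : Fin n, u (k, a) = 0 := by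
    intro t
    induction t with
    | zero => intro a _ h2 k; exact hN k a (by simpa using h2)
    | succ t ih =>
      intro a h1 h2 k
      push_cast at h2
      have hprev : ∀ k : Fin n, u (k, a - 1 / 2 - 1 / 2) = 0 :=
        fun k => ih _ (by linarith) (by linarith) k
      induction k using WellFoundedLT.induction with
      | ind k ihk =>
        have e := congrFun h (k, a - 1 / 2)
        have hne : ((k, a - 1 / 2) : Fin n × ℝ) ≠ (j, 0) := by
          intro hh
          have := congrArg Prod.snd hh
          simp only at this
          linarith
        have s1 : ∑ i : Fin n, (if i < k then b i k * u (i, a) else 0) = 0 := by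
          apply Finset.sum_eq_zero
          intro i _
          split_ifs with hi
          · rw [ihk i hi, mul_zero]
          · rfl
        simp only [GQV.Cq, GQV.eind, if_neg hne, hprev, sub_add_cancel, s1] at e
        simpa using e
  obtain ⟨t, ht⟩ := exists_nat_gt (a - N)
  exact key t a ha (by linarith) k

theorem GQV.dotP_shift_aux {n : ℕ} (i : Fin n) (u : Fin n × ℝ → ℤ)
    (hu : ∀ (k : Fin n) (a : ℝ), a < 1 / 2 → u (k, a) = 0) :
    GQV.dotP (GQV.shift (GQV.eind i (0 : ℝ)) (1 / 2)) u = 0 := by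
  unfold GQV.dotP
  apply finsum_eq_zero_of_forall_eq_zero
  intro p
  obtain ⟨k, a⟩ := p
  simp only [GQV.shift, GQV.eind]
  split_ifs with hp
  · have := congrArg Prod.snd hp
    simp only at this
    rw [hu k a (by linarith), mul_zero]
  · simp

/-- `ℰ'(e_i(0), e_j(0)) = 0`.
Here `u₁ = C_q⁻¹ e_i(0)` and `u₂ = C_q⁻¹ e_j(0)`. -/
theorem Ecal_zero_zero (n : ℕ) (hn : 0 < n) (b : Matrix (Fin n) (Fin n) ℤ)
    (hskew : bᵀ = -b) (hsign : ∀ i j : Fin n, i < j → 0 ≤ b i j)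
    (i j : Fin n) (u₁ u₂ : Fin n × ℝ → ℤ)
    (hu₁ : GQV.memEhalf u₁) (hu₂ : GQV.memEhalf u₂)
    (hu₁Cq : GQV.Cq b u₁ = GQV.eind i (0 : ℝ))
    (hu₂Cq : GQV.Cq b u₂ = GQV.eind j (0 : ℝ)) :
    GQV.Ecal (GQV.eind i (0 : ℝ)) (GQV.eind j (0 : ℝ)) u₁ u₂ = 0 := by
  unfold GQV.Ecal
  rw [GQV.dotP_shift_aux i u₂ (GQV.vanish_aux b j u₂ hu₂ hu₂Cq),
    GQV.dotP_shift_aux j u₁ (GQV.vanish_aux b i u₁ hu₁ hu₁Cq)]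
  simp
end
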